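/- Let a pH descriptor system be given with ker E ∩ ker Q = {0}. Define L = ran [E; Q] ⊆ K^n × K^n, R = {(w, −Ww) : w ∈ K^{n+m}} ⊆ K^{n+m} × K^{n+m} with W = [R̃, P; P*, S] ≥ 0, and D = gr⁻¹(U D̃ U*) with Γ = [J, B; −B*, −N], D̃ = [−Γ, −I; I, 0], and U the stated permutation matrix. Then L is a Lagrange structure, R is a maximal resistive structure, and D is a Dirac structure. -/

import Mathlib

open scoped BigOperators
open Matrix

noncomputable section

variable {𝕜 : Type*} [RCLike 𝕜]

/-- The pairing ⟨x,y⟩ = y*x = ∑ conj(y i) * x i. -/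
def herm {ι : Type*} [Fintype ι] (x y : ι → 𝕜) : 𝕜 :=
  ∑ i, (starRingEnd 𝕜) (y i) * x i

/-- The adjoint relation A* = {(e',f') : ⟨f',e⟩ = ⟨e',f⟩ for all (e,f) ∈ A}. -/
def adjRel {ι : Type*} [Fintype ι] (A : Submodule 𝕜 ((ι → 𝕜) × (ι → 𝕜))) :
    Submodule 𝕜 ((ι → 𝕜) × (ι → 𝕜)) where
  carrier := {p | ∀ q ∈ A, herm p.2 q.1 = herm p.1 q.2}
  add_mem' := by
    intro a b ha hb q hq
    have h1 := ha q hq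
    have h2 := hb q hq
    simp only [herm, Prod.snd_add, Prod.fst_add, Pi.add_apply, mul_add,
      Finset.sum_add_distrib] at *
    rw [h1, h2]
  zero_mem' := by
    intro q hq
    simp [herm]
  smul_mem' := by
    intro c p hp q hq
    have h := hp q hq
    simp only [herm, Prod.smul_snd, Prod.smul_fst, Pi.smul_apply, smul_eq_mul] at *
    calc ∑ i, (starRingEnd 𝕜) (q.1 i) * (c * p.2 i)
        = c * ∑ i, (starRingEnd 𝕜) (q.1 i) * p.2 i := by
          rw [Finset.mul_sum]; congr 1; ext i; ring
      _ = c * ∑ i, (starRingEnd 𝕜) (q.2 i) * p.1 i := by rw [h]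
      _ = ∑ i, (starRingEnd 𝕜) (q.2 i) * (c * p.1 i) := by
          rw [Finset.mul_sum]; congr 1; ext i; ring

/-- The relation −A* = {(e',−f') : (e',f') ∈ A*}. -/
def negAdj {ι : Type*} [Fintype ι] (A : Submodule 𝕜 ((ι → 𝕜) × (ι → 𝕜))) :
    Submodule 𝕜 ((ι → 𝕜) × (ι → 𝕜)) :=
  (adjRel A).map ((LinearMap.fst 𝕜 (ι → 𝕜) (ι → 𝕜)).prod (-(LinearMap.snd 𝕜 (ι → 𝕜) (ι → 𝕜))))

/-- Kernel representation ker [K, L] = {(f,e) : Kf + Le = 0}. -/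
def kerRep {p n : ℕ} (K L : Matrix (Fin p) (Fin n) 𝕜) :
    Submodule 𝕜 ((Fin n → 𝕜) × (Fin n → 𝕜)) :=
  LinearMap.ker (K.mulVecLin.comp (LinearMap.fst 𝕜 (Fin n → 𝕜) (Fin n → 𝕜)) +
    L.mulVecLin.comp (LinearMap.snd 𝕜 (Fin n → 𝕜) (Fin n → 𝕜)))

/-- Image representation ran [F; G] = {(Fx, Gx) : x}. -/
def ranRep {n m : ℕ} (F G : Matrix (Fin n) (Fin m) 𝕜) :
    Submodule 𝕜 ((Fin n → 𝕜) × (Fin n → 𝕜)) :=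
  LinearMap.range (F.mulVecLin.prod G.mulVecLin)

/-- The kernel of a linear relation: ker A = {f : (f,0) ∈ A}. -/
def kerRel {ι : Type*} [Fintype ι] (A : Submodule 𝕜 ((ι → 𝕜) × (ι → 𝕜))) :
    Submodule 𝕜 (ι → 𝕜) :=
  A.comap (LinearMap.prod LinearMap.id 0)

end
open scoped ComplexOrder

/-- The permutation underlying the matrix U, sending the row blocks (n, r, m),
with r-block indexed by Fin n ⊕ Fin m, to the column blocks (n, m, r) grouped as
(Fin n ⊕ Fin m) ⊕ (Fin n ⊕ Fin m). -/
def Usigma {n m : ℕ} : (Fin n ⊕ ((Fin n ⊕ Fin m) ⊕ Fin m)) →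
    ((Fin n ⊕ Fin m) ⊕ (Fin n ⊕ Fin m))
  | Sum.inl i => Sum.inl (Sum.inl i)
  | Sum.inr (Sum.inl j) => Sum.inr j
  | Sum.inr (Sum.inr k) => Sum.inl (Sum.inr k)

section Hermitian

variable {𝕜 : Type*} [RCLike 𝕜] {ι κ : Type*} [Fintype ι] [Fintype κ]

theorem herm_eq_dotProduct (x y : ι → 𝕜) : herm x y = star y ⬝ᵥ x := rfl

theorem herm_neg_left (x y : ι → 𝕜) : herm (-x) y = -herm x y := by
  simp [herm_eq_dotProduct]

theorem herm_neg_right (x y : ι → 𝕜) : herm x (-y) = -herm x y := by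
  simp [herm_eq_dotProduct]

theorem herm_mulVec_right (A : Matrix ι κ 𝕜) (x : ι → 𝕜) (y : κ → 𝕜) :
    herm x (A *ᵥ y) = herm (Aᴴ *ᵥ x) y := by
  rw [herm_eq_dotProduct, herm_eq_dotProduct, star_mulVec, dotProduct_mulVec]

theorem eq_of_forall_herm_eq {x y : ι → 𝕜} (h : ∀ z, herm x z = herm y z) : x = y := by
  refine dotProduct_eq x y fun z => ?_
  simpa [herm_eq_dotProduct, dotProduct_comm] using h (star z)

theorem mem_adjRel_range_prod (F G : Matrix ι κ 𝕜) (p : (ι → 𝕜) × (ι → 𝕜)) :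
    p ∈ adjRel (LinearMap.range (F.mulVecLin.prod G.mulVecLin)) ↔
      Fᴴ *ᵥ p.2 = Gᴴ *ᵥ p.1 := by
  constructor
  · refine fun h => eq_of_forall_herm_eq fun z => ?_
    rw [← herm_mulVec_right, ← herm_mulVec_right]
    exact h _ ⟨z, rfl⟩
  · rintro h _ ⟨z, rfl⟩
    change herm p.2 (F *ᵥ z) = herm p.1 (G *ᵥ z)
    rw [herm_mulVec_right, herm_mulVec_right, h]

/-- Two matrices with trivial common kernel have jointly surjective adjoints. -/
theorem exists_conjTranspose_mulVec_add_eq [DecidableEq κ] (F G : Matrix ι κ 𝕜)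
    (hker : ∀ z, F *ᵥ z = 0 → G *ᵥ z = 0 → z = 0) (y : κ → 𝕜) :
    ∃ z, Fᴴ *ᵥ (F *ᵥ z) + Gᴴ *ᵥ (G *ᵥ z) = y := by
  have hinj : Function.Injective (Fᴴ * F + Gᴴ * G).mulVecLin := by
    rw [← LinearMap.ker_eq_bot, LinearMap.ker_eq_bot']
    intro z hz
    have hz' : ((fromRows F G)ᴴ * fromRows F G) *ᵥ z = 0 := by
      rwa [conjTranspose_fromRows_eq_fromCols_conjTranspose, fromCols_mul_fromRows]
    rw [conjTranspose_mul_self_mulVec_eq_zero, fromRows_mulVec] at hz'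
    exact hker z (funext fun i => congrFun hz' (.inl i)) (funext fun i => congrFun hz' (.inr i))
  obtain ⟨z, hz⟩ := LinearMap.injective_iff_surjective.mp hinj y
  exact ⟨z, by simpa [add_mulVec] using hz⟩

/-- The image of `[F; G]`, with `F` and `G` square, is a Lagrange structure if `Fᴴ * G` is
Hermitian and the common kernel of `F` and `G` is trivial. -/
theorem range_prod_eq_adjRel [DecidableEq ι] (F G : Matrix ι ι 𝕜) (hFG : Fᴴ * G = Gᴴ * F)
    (hker : ∀ z, F *ᵥ z = 0 → G *ᵥ z = 0 → z = 0) :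
    LinearMap.range (F.mulVecLin.prod G.mulVecLin) =
      adjRel (LinearMap.range (F.mulVecLin.prod G.mulVecLin)) := by
  let T : ((ι → 𝕜) × (ι → 𝕜)) →ₗ[𝕜] (ι → 𝕜) :=
    Fᴴ.mulVecLin.comp (LinearMap.snd 𝕜 _ _) - Gᴴ.mulVecLin.comp (LinearMap.fst 𝕜 _ _)
  have hadj : adjRel (LinearMap.range (F.mulVecLin.prod G.mulVecLin)) = LinearMap.ker T := by
    ext p
    rw [mem_adjRel_range_prod, LinearMap.mem_ker]
    exact sub_eq_zero.symm
  have hsurj : LinearMap.range T = ⊤ := by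
    refine LinearMap.range_eq_top.mpr fun y => ?_
    obtain ⟨z, hz⟩ := exists_conjTranspose_mulVec_add_eq F G hker y
    refine ⟨(-(G *ᵥ z), F *ᵥ z), ?_⟩
    change Fᴴ *ᵥ (F *ᵥ z) - Gᴴ *ᵥ (-(G *ᵥ z)) = y
    rw [mulVec_neg, sub_neg_eq_add, hz]
  have hinj : Function.Injective (F.mulVecLin.prod G.mulVecLin) := by
    rw [← LinearMap.ker_eq_bot, LinearMap.ker_eq_bot']
    intro z hz
    exact hker z (congrArg Prod.fst hz) (congrArg Prod.snd hz)
  rw [hadj]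
  refine Submodule.eq_of_le_of_finrank_eq ?_ ?_
  · rintro _ ⟨z, rfl⟩
    change Fᴴ *ᵥ (G *ᵥ z) - Gᴴ *ᵥ (F *ᵥ z) = 0
    rw [mulVec_mulVec, mulVec_mulVec, hFG, sub_self]
  · have hrank := T.finrank_range_add_finrank_ker
    rw [hsurj, finrank_top, Module.finrank_prod] at hrank
    rw [LinearMap.finrank_range_of_inj hinj]
    omega

theorem graph_neg_le_adjRel {W : Matrix ι ι 𝕜} (hW : W.IsHermitian) :
    LinearMap.range (LinearMap.prod LinearMap.id (-W.mulVecLin)) ≤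
      adjRel (LinearMap.range (LinearMap.prod LinearMap.id (-W.mulVecLin))) := by
  rintro _ ⟨w, rfl⟩ _ ⟨v, rfl⟩
  change herm (-(W *ᵥ w)) v = herm w (-(W *ᵥ v))
  rw [herm_neg_left, herm_neg_right, herm_mulVec_right, hW.eq]

theorem herm_graph_neg_nonpos {W : Matrix ι ι 𝕜} (hW : W.PosSemidef) (w : ι → 𝕜) :
    RCLike.im (herm w (-(W *ᵥ w))) = 0 ∧ RCLike.re (herm w (-(W *ᵥ w))) ≤ 0 := by
  have h := RCLike.nonneg_iff.mp (hW.dotProduct_mulVec_nonneg w)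
  rw [herm_neg_right, herm_mulVec_right, hW.isHermitian.eq, herm_eq_dotProduct, map_neg, map_neg]
  exact ⟨by rw [h.2, neg_zero], neg_nonpos.mpr h.1⟩

theorem finrank_range_id_prod (f : (ι → 𝕜) →ₗ[𝕜] (ι → 𝕜)) :
    Module.finrank 𝕜 (LinearMap.range (LinearMap.prod LinearMap.id f)) = Fintype.card ι := by
  have hinj : Function.Injective (LinearMap.prod LinearMap.id f) :=
    fun _ _ h => congrArg Prod.fst h
  rw [LinearMap.finrank_range_of_inj hinj, Module.finrank_fintype_fun_eq_card]

/-- The inverse graph of a skew-Hermitian matrix is a Dirac structure. -/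
theorem inverse_graph_eq_negAdj [DecidableEq ι] {M : Matrix ι ι 𝕜} (hM : Mᴴ = -M) :
    LinearMap.range (LinearMap.prod M.mulVecLin LinearMap.id) =
      negAdj (LinearMap.range (LinearMap.prod M.mulVecLin LinearMap.id)) := by
  have hadj (p : (ι → 𝕜) × (ι → 𝕜)) :
      p ∈ adjRel (LinearMap.range (LinearMap.prod M.mulVecLin LinearMap.id)) ↔
        -(M *ᵥ p.2) = p.1 := by
    rw [← mulVecLin_one, mem_adjRel_range_prod, hM, neg_mulVec, conjTranspose_one, one_mulVec]
  ext p
  constructor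
  · rintro ⟨x, rfl⟩
    refine ⟨(M *ᵥ x, -x), (hadj _).mpr ?_, ?_⟩
    · rw [mulVec_neg, neg_neg]
    · exact Prod.ext rfl (neg_neg x)
  · rintro ⟨q, hq, rfl⟩
    refine ⟨-q.2, Prod.ext ?_ rfl⟩
    change M *ᵥ (-q.2) = q.1
    rw [mulVec_neg, (hadj q).mp hq]

end Hermitian

/-- from a pH descriptor system with ker E ∩ ker Q = {0}, the spaces
L = ran [E; Q], R = {(w, -Ww)}, and D = gr⁻¹(U D̃ U*) form a geometric pH system:
L is a Lagrange structure, R is a maximal resistive structure, D is a Dirac structure. -/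
theorem descriptor_to_geometric {𝕜 : Type*} [RCLike 𝕜] {n m : ℕ}
    (E J Rt Q : Matrix (Fin n) (Fin n) 𝕜) (B P : Matrix (Fin n) (Fin m) 𝕜)
    (S N : Matrix (Fin m) (Fin m) 𝕜)
    (hEQ : Eᴴ * Q = Qᴴ * E) (hJ : Jᴴ = -J) (hN : Nᴴ = -N) (hRt : Rtᴴ = Rt) (hS : Sᴴ = S)
    (hW : (Matrix.fromBlocks Rt P Pᴴ S).PosSemidef)
    (hker : ∀ z : Fin n → 𝕜, E.mulVec z = 0 → Q.mulVec z = 0 → z = 0)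
    -- the constructed structures:
    (Lag : Submodule 𝕜 ((Fin n → 𝕜) × (Fin n → 𝕜)))
    (hLag : Lag = LinearMap.range (E.mulVecLin.prod Q.mulVecLin))
    (Res : Submodule 𝕜 ((Fin n ⊕ Fin m → 𝕜) × (Fin n ⊕ Fin m → 𝕜)))
    (hRes : Res = LinearMap.range (LinearMap.prod LinearMap.id
      (-(Matrix.fromBlocks Rt P Pᴴ S).mulVecLin)))
    (Γ : Matrix (Fin n ⊕ Fin m) (Fin n ⊕ Fin m) 𝕜)
    (hΓ : Γ = Matrix.fromBlocks J B (-Bᴴ) (-N))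
    (Dt : Matrix ((Fin n ⊕ Fin m) ⊕ (Fin n ⊕ Fin m))
      ((Fin n ⊕ Fin m) ⊕ (Fin n ⊕ Fin m)) 𝕜)
    (hDt : Dt = Matrix.fromBlocks (-Γ) (-1) 1 0)
    (U : Matrix (Fin n ⊕ ((Fin n ⊕ Fin m) ⊕ Fin m))
      ((Fin n ⊕ Fin m) ⊕ (Fin n ⊕ Fin m)) 𝕜)
    (hU : U = Matrix.of fun i k => if Usigma i = k then 1 else 0)
    (Dir : Submodule 𝕜 ((Fin n ⊕ ((Fin n ⊕ Fin m) ⊕ Fin m) → 𝕜) ×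
      (Fin n ⊕ ((Fin n ⊕ Fin m) ⊕ Fin m) → 𝕜)))
    (hDir : Dir = LinearMap.range (LinearMap.prod (U * Dt * Uᴴ).mulVecLin LinearMap.id)) :
    -- L is a Lagrange structure:
    Lag = adjRel Lag
    -- R is a maximal resistive structure:
    ∧ (Res ≤ adjRel Res
        ∧ (∀ p ∈ Res, RCLike.im (herm p.1 p.2) = 0 ∧ RCLike.re (herm p.1 p.2) ≤ 0)
        ∧ Module.finrank 𝕜 Res = n + m)
    -- D is a Dirac structure:
    ∧ Dir = negAdj Dir := by
  subst hLag hRes hDir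
  refine ⟨range_prod_eq_adjRel E Q hEQ hker, ⟨graph_neg_le_adjRel hW.isHermitian, ?_, ?_⟩,
    inverse_graph_eq_negAdj ?_⟩
  · rintro _ ⟨w, rfl⟩
    exact herm_graph_neg_nonpos hW w
  · rw [finrank_range_id_prod, Fintype.card_sum, Fintype.card_fin, Fintype.card_fin]
  · have hΓskew : Γᴴ = -Γ := by
      rw [hΓ, fromBlocks_conjTranspose, fromBlocks_neg]
      simp [hJ, hN]
    have hDskew : Dtᴴ = -Dt := by
      rw [hDt, fromBlocks_conjTranspose, fromBlocks_neg]
      simp [hΓskew]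
    simp [conjTranspose_mul, hDskew, Matrix.mul_assoc]
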